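/- There exists an absolute constant c > 0 with the following property. Let A, B ⊆ ℝ be finite sets, let G ⊆ A × B, and let α, β ∈ ℝ with α ≠ β. Then max{|A +_G B|, |A ·_G B|, |(A + α) ·_G (B + β)|} ≥ c · |G|^(6/11). -/

import Mathlib

/-- The quadric traced by `(a + b, a * b, (a + α) * (b + α + 1) - α * (α + 1))`. -/
def OnQuadric (α s p r : ℝ) : Prop :=
  (r - p - α * s) * (r - p - (α + 1) * s) + p = 0

section Counting

open Polynomial

lemma card_le_of_eval_eq_zero {T : Finset ℝ} {f : ℝ[X]} (hf : f ≠ 0) {n : ℕ}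
    (hn : f.natDegree ≤ n) (hT : ∀ x ∈ T, f.eval x = 0) : T.card ≤ n := by
  refine (Finset.card_le_card (t := f.roots.toFinset) fun x hx => ?_).trans
    ((Multiset.toFinset_card_le _).trans ((card_roots' f).trans hn))
  simpa [hf] using hT x hx

lemma card_le_two_of_quadratic {T : Finset ℝ} {a b c : ℝ} (hab : a ≠ 0 ∨ b ≠ 0)
    (hT : ∀ x ∈ T, a * x ^ 2 + b * x + c = 0) : T.card ≤ 2 := by
  refine card_le_of_eval_eq_zero (f := C a * X ^ 2 + C b * X + C c) (fun h => ?_) (by compute_degree)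
    fun x hx => by simpa using hT x hx
  have h2 := congrArg (fun q : ℝ[X] => q.coeff 2) h
  have h1 := congrArg (fun q : ℝ[X] => q.coeff 1) h
  simp [coeff_C] at h1 h2
  tauto

/-- If the differences of the pairs in `T` are roots of `f`, and for each difference the sum
satisfies a nontrivial quadratic equation, then `T` has at most `2 * natDegree f` elements. -/
lemma card_le_of_sub_root {T : Finset (ℝ × ℝ)} {f : ℝ[X]} (hf : f ≠ 0) {n : ℕ}
    (hn : f.natDegree ≤ n) (a b c : ℝ → ℝ)
    (hT : ∀ z ∈ T, f.eval (z.1 - z.2) = 0 ∧ (a (z.1 - z.2) ≠ 0 ∨ b (z.1 - z.2) ≠ 0) ∧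
      a (z.1 - z.2) * (z.1 + z.2) ^ 2 + b (z.1 - z.2) * (z.1 + z.2) + c (z.1 - z.2) = 0) :
    T.card ≤ 2 * n := by
  have himage : (T.image fun z => z.1 - z.2).card ≤ n := by
    refine card_le_of_eval_eq_zero hf hn fun x hx => ?_
    obtain ⟨z, hz, rfl⟩ := Finset.mem_image.1 hx
    exact (hT z hz).1
  refine (Finset.card_le_mul_card_image T 2 fun t ht => ?_).trans (Nat.mul_le_mul_left 2 himage)
  obtain ⟨z₀, hz₀, rfl⟩ := Finset.mem_image.1 ht
  rw [← Finset.card_image_of_injOn (f := fun z : ℝ × ℝ => z.1 + z.2)]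
  · refine card_le_two_of_quadratic (hT z₀ hz₀).2.1 (c := c (z₀.1 - z₀.2)) fun x hx => ?_
    obtain ⟨z, hz, rfl⟩ := Finset.mem_image.1 hx
    obtain ⟨hz, he⟩ := Finset.mem_filter.1 hz
    have := (hT z hz).2.2
    rwa [he] at this
  · intro z hz w hw h
    have hz := (Finset.mem_filter.1 hz).2
    have hw := (Finset.mem_filter.1 hw).2
    dsimp only at hz hw h
    ext <;> linarith

end Counting

section Algebra

open Polynomial

variable {α s₁ s₂ p₁ p₂ r : ℝ}

lemma OnQuadric.linear (h₁ : OnQuadric α s₁ p₁ r) (h₂ : OnQuadric α s₂ p₂ r) :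
    (2 * (p₁ - p₂) + (2 * α + 1) * (s₁ - s₂)) *
        (4 * r - 2 * (p₁ + p₂) - (2 * α + 1) * (s₁ + s₂)) =
      4 * (p₁ - p₂) - (s₁ - s₂) * (s₁ + s₂) := by
  unfold OnQuadric at h₁ h₂
  linear_combination 4 * h₂ - 4 * h₁

lemma OnQuadric.quadratic (h₁ : OnQuadric α s₁ p₁ r) (h₂ : OnQuadric α s₂ p₂ r) :
    ((p₁ - p₂) + α * (s₁ - s₂)) * ((p₁ - p₂) + (α + 1) * (s₁ - s₂)) * (s₁ + s₂) ^ 2 +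
      2 * (p₁ - p₂) * (s₁ - s₂) * (s₁ + s₂) -
      (4 * (p₁ - p₂) ^ 2 + (2 * (p₁ + p₂) +
        ((p₁ - p₂) + α * (s₁ - s₂)) * ((p₁ - p₂) + (α + 1) * (s₁ - s₂))) *
        (2 * (p₁ - p₂) + (2 * α + 1) * (s₁ - s₂)) ^ 2) = 0 := by
  have hL := h₁.linear h₂
  unfold OnQuadric at h₁ h₂
  generalize hY : 4 * r - 2 * (p₁ + p₂) - (2 * α + 1) * (s₁ + s₂) = Y at hL
  have hS : Y ^ 2 / 4 + ((p₁ - p₂) + α * (s₁ - s₂)) * ((p₁ - p₂) + (α + 1) * (s₁ - s₂)) =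
      (s₁ + s₂) ^ 2 / 4 - 2 * (p₁ + p₂) := by
    rw [← hY]
    linear_combination 2 * h₁ + 2 * h₂
  generalize hK : 2 * (p₁ - p₂) + (2 * α + 1) * (s₁ - s₂) = K at hL ⊢
  have hKX : K ^ 2 = 4 * (((p₁ - p₂) + α * (s₁ - s₂)) * ((p₁ - p₂) + (α + 1) * (s₁ - s₂))) +
      (s₁ - s₂) ^ 2 := by
    rw [← hK]; ring
  linear_combination (-K ^ 2) * hS + (K * Y + (4 * (p₁ - p₂) - (s₁ - s₂) * (s₁ + s₂))) / 4 * hL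
    - (s₁ + s₂) ^ 2 / 4 * hKX


/-- The equation relating `t = s₁ - s₂` and `u = s₁ + s₂`, where `d` and `m` are the difference and
the sum of the two products. -/
def PairEquation (α d m t u : ℝ) : Prop :=
  (d + α * t) * (d + (α + 1) * t) * u ^ 2 + 2 * d * t * u -
    (4 * d ^ 2 + (2 * m + (d + α * t) * (d + (α + 1) * t)) * (2 * d + (2 * α + 1) * t) ^ 2) = 0

lemma resultant_eq_zero {a₁ b₁ c₁ a₂ b₂ c₂ u : ℝ} (h₁ : a₁ * u ^ 2 + b₁ * u - c₁ = 0)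
    (h₂ : a₂ * u ^ 2 + b₂ * u - c₂ = 0) :
    (a₁ * c₂ - a₂ * c₁) ^ 2 + (a₁ * b₂ - a₂ * b₁) * (b₁ * c₂ - b₂ * c₁) = 0 := by
  have e₁ : (a₁ * b₂ - a₂ * b₁) * u = a₁ * c₂ - a₂ * c₁ := by
    linear_combination a₁ * h₂ - a₂ * h₁
  have e₂ : (a₁ * b₂ - a₂ * b₁) * u ^ 2 = b₂ * c₁ - b₁ * c₂ := by
    linear_combination b₂ * h₁ - b₁ * h₂
  linear_combination (-(a₁ * c₂ - a₂ * c₁) - (a₁ * b₂ - a₂ * b₁) * u) * e₁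
    + (a₁ * b₂ - a₂ * b₁) * e₂

lemma ne_zero_of_sq_add {f g : ℝ[X]} {n : ℕ} (hf : f.natDegree ≤ n) (hc : f.coeff n ≠ 0)
    (hg : g.natDegree < 2 * n) : f ^ 2 + g ≠ 0 := by
  intro h
  have := congrArg (fun q : ℝ[X] => q.coeff (2 * n)) h
  rw [coeff_add, coeff_eq_zero_of_natDegree_lt hg, coeff_pow_of_natDegree_le hf] at this
  simp at this
  exact hc this

lemma leading_ne_zero {α d t : ℝ} (hα : α * (α + 1) ≠ 0) (ht : t ≠ 0) :
    (d + α * t) * (d + (α + 1) * t) ≠ 0 ∨ 2 * d * t ≠ 0 := by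
  by_cases hd : d = 0
  · left
    subst hd
    have : (0 + α * t) * (0 + (α + 1) * t) = α * (α + 1) * (t * t) := by ring
    rw [this]
    exact mul_ne_zero hα (mul_ne_zero ht ht)
  · right
    positivity

lemma card_le_of_generic {α d₁ d₂ m₁ m₂ : ℝ} (hα : α * (α + 1) ≠ 0) (hσ : 2 * α + 1 ≠ 0)
    (hd : d₁ ≠ d₂) {T : Finset (ℝ × ℝ)}
    (hT : ∀ z ∈ T, z.1 ≠ z.2 ∧ PairEquation α d₁ m₁ (z.1 - z.2) (z.1 + z.2) ∧
      PairEquation α d₂ m₂ (z.1 - z.2) (z.1 + z.2)) : T.card ≤ 20 := by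
  let A (d : ℝ) : ℝ[X] := (C d + C α * X) * (C d + C (α + 1) * X)
  let K (d : ℝ) : ℝ[X] := C (2 * d) + C (2 * α + 1) * X
  let f : ℝ[X] := A d₁ * A d₂ * (C (4 * (d₂ - d₁)) * (C (d₁ + d₂) + C (2 * α + 1) * X)) +
    (C (2 * m₂) * A d₁ * K d₂ ^ 2 - C (2 * m₁) * A d₂ * K d₁ ^ 2 +
      (C (4 * d₂ ^ 2) * A d₁ - C (4 * d₁ ^ 2) * A d₂))
  let g : ℝ[X] := (A d₁ * (C (2 * d₂) * X) - A d₂ * (C (2 * d₁) * X)) *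
    (C (2 * d₁) * X * (C (4 * d₂ ^ 2) + (C (2 * m₂) + A d₂) * K d₂ ^ 2) -
      C (2 * d₂) * X * (C (4 * d₁ ^ 2) + (C (2 * m₁) + A d₁) * K d₁ ^ 2))
  have hfn : f.natDegree ≤ 5 := by
    simp only [f, A, K]
    compute_degree
  have hfc : f.coeff 5 = α ^ 2 * (α + 1) ^ 2 * (4 * (d₂ - d₁)) * (2 * α + 1) := by
    simp only [f, A, K]
    compute_degree!
    ring
  have hgn : g.natDegree ≤ 8 := by
    simp only [g, A, K]
    compute_degree
  have hne : f ^ 2 + g ≠ 0 := by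
    refine ne_zero_of_sq_add hfn ?_ (by omega)
    rw [hfc]
    have : d₂ - d₁ ≠ 0 := sub_ne_zero.2 hd.symm
    obtain ⟨h1, h2⟩ := mul_ne_zero_iff.1 hα
    positivity
  refine card_le_of_sub_root hne (n := 10) ?_ (fun t => (d₁ + α * t) * (d₁ + (α + 1) * t))
    (fun t => 2 * d₁ * t) (fun t => -(4 * d₁ ^ 2 + (2 * m₁ + (d₁ + α * t) * (d₁ + (α + 1) * t)) *
      (2 * d₁ + (2 * α + 1) * t) ^ 2)) fun z hz => ?_
  · refine (natDegree_add_le _ _).trans (max_le ((natDegree_pow_le).trans ?_) ?_) <;> omega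
  · obtain ⟨hz, h₁, h₂⟩ := hT z hz
    refine ⟨?_, leading_ne_zero hα (sub_ne_zero.2 hz), by rw [← sub_eq_add_neg]; exact h₁⟩
    have hfe (t : ℝ) : f.eval t = (A d₁).eval t * (C (4 * d₂ ^ 2) + (C (2 * m₂) + A d₂) *
        K d₂ ^ 2).eval t - (A d₂).eval t * (C (4 * d₁ ^ 2) + (C (2 * m₁) + A d₁) *
        K d₁ ^ 2).eval t := by
      have hK : C (4 * (d₂ - d₁)) * (C (d₁ + d₂) + C (2 * α + 1) * X) = K d₂ ^ 2 - K d₁ ^ 2 := by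
        simp only [K, map_add, map_mul, map_sub, map_ofNat, map_one]
        ring
      simp only [f]
      rw [hK]
      simp only [eval_add, eval_sub, eval_mul, eval_C]
      ring
    have hR := resultant_eq_zero h₁ h₂
    rw [eval_add, eval_pow, hfe]
    simp only [g, A, K, eval_add, eval_sub, eval_mul, eval_pow, eval_C, eval_X]
    exact hR

lemma card_le_of_symmetric {α d₁ d₂ m₁ m₂ : ℝ} (hα : α * (α + 1) ≠ 0) (hσ : 2 * α + 1 = 0)
    (hd : d₁ ^ 2 ≠ d₂ ^ 2) {T : Finset (ℝ × ℝ)}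
    (hT : ∀ z ∈ T, z.1 ≠ z.2 ∧ PairEquation α d₁ m₁ (z.1 - z.2) (z.1 + z.2) ∧
      PairEquation α d₂ m₂ (z.1 - z.2) (z.1 + z.2)) : T.card ≤ 16 := by
  let A (d : ℝ) : ℝ[X] := (C d + C α * X) * (C d + C (α + 1) * X)
  let f : ℝ[X] := C (4 * (d₂ ^ 2 - d₁ ^ 2)) * A d₁ * A d₂ +
    (C (2 * m₂ * (4 * d₂ ^ 2)) * A d₁ - C (2 * m₁ * (4 * d₁ ^ 2)) * A d₂ +
      (C (4 * d₂ ^ 2) * A d₁ - C (4 * d₁ ^ 2) * A d₂))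
  let g : ℝ[X] := (A d₁ * (C (2 * d₂) * X) - A d₂ * (C (2 * d₁) * X)) *
    (C (2 * d₁) * X * (C (4 * d₂ ^ 2) + (C (2 * m₂) + A d₂) * C (4 * d₂ ^ 2)) -
      C (2 * d₂) * X * (C (4 * d₁ ^ 2) + (C (2 * m₁) + A d₁) * C (4 * d₁ ^ 2)))
  have hfn : f.natDegree ≤ 4 := by
    simp only [f, A]
    compute_degree
  have hfc : f.coeff 4 = α ^ 2 * (α + 1) ^ 2 * (4 * (d₂ ^ 2 - d₁ ^ 2)) := by
    simp only [f, A]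
    compute_degree!
    ring
  have hgn : g.natDegree ≤ 6 := by
    simp only [g, A]
    compute_degree
  have hne : f ^ 2 + g ≠ 0 := by
    refine ne_zero_of_sq_add hfn ?_ (by omega)
    rw [hfc]
    have : d₂ ^ 2 - d₁ ^ 2 ≠ 0 := sub_ne_zero.2 hd.symm
    obtain ⟨h1, h2⟩ := mul_ne_zero_iff.1 hα
    positivity
  refine card_le_of_sub_root hne (n := 8) ?_ (fun t => (d₁ + α * t) * (d₁ + (α + 1) * t))
    (fun t => 2 * d₁ * t) (fun t => -(4 * d₁ ^ 2 + (2 * m₁ + (d₁ + α * t) * (d₁ + (α + 1) * t)) *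
      (2 * d₁ + (2 * α + 1) * t) ^ 2)) fun z hz => ?_
  · refine (natDegree_add_le _ _).trans (max_le ((natDegree_pow_le).trans ?_) ?_) <;> omega
  · obtain ⟨hz, h₁, h₂⟩ := hT z hz
    refine ⟨?_, leading_ne_zero hα (sub_ne_zero.2 hz), by rw [← sub_eq_add_neg]; exact h₁⟩
    have hR := resultant_eq_zero h₁ h₂
    simp only [hσ, zero_mul, add_zero] at hR
    have hfe (t : ℝ) : f.eval t = (A d₁).eval t * (4 * d₂ ^ 2 + (2 * m₂ + (A d₂).eval t) *
        (2 * d₂) ^ 2) - (A d₂).eval t * (4 * d₁ ^ 2 + (2 * m₁ + (A d₁).eval t) *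
        (2 * d₁) ^ 2) := by
      simp only [f, eval_add, eval_sub, eval_mul, eval_C]
      ring
    have hsq (d : ℝ) : 4 * d ^ 2 = (2 * d) ^ 2 := by ring
    rw [eval_add, eval_pow, hfe]
    simp only [g, A, eval_add, eval_sub, eval_mul, eval_C, eval_X, hsq] at hR ⊢
    exact hR

lemma card_le_of_antisymmetric {α d m₁ m₂ : ℝ} (hα : α * (α + 1) ≠ 0) (hσ : 2 * α + 1 = 0)
    (hd : d ≠ 0) {T : Finset (ℝ × ℝ)}
    (hT : ∀ z ∈ T, z.1 ≠ z.2 ∧ PairEquation α d m₁ (z.1 - z.2) (z.1 + z.2) ∧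
      PairEquation α (-d) m₂ (z.1 - z.2) (z.1 + z.2)) : T.card ≤ 8 := by
  let A : ℝ[X] := (C d + C α * X) * (C d + C (α + 1) * X)
  let f : ℝ[X] := C ((m₁ - m₂) ^ 2) * A - X ^ 2 * (C (1 + m₁ + m₂) + A)
  have hfn : f.natDegree ≤ 4 := by
    simp only [f, A]
    compute_degree
  have hfc : f.coeff 4 = -(α * (α + 1)) := by
    simp only [f, A]
    compute_degree!
  have hne : f ≠ 0 := by
    intro h
    rw [h, coeff_zero] at hfc
    exact hα (by linarith)
  refine card_le_of_sub_root hne hfn (fun t => (d + α * t) * (d + (α + 1) * t))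
    (fun t => 2 * d * t) (fun t => -(4 * d ^ 2 + (2 * m₁ + (d + α * t) * (d + (α + 1) * t)) *
      (2 * d + (2 * α + 1) * t) ^ 2)) fun z hz => ?_
  obtain ⟨hz, h₁, h₂⟩ := hT z hz
  refine ⟨?_, leading_ne_zero hα (sub_ne_zero.2 hz), by rw [← sub_eq_add_neg]; exact h₁⟩
  simp only [PairEquation] at h₁ h₂
  generalize z.1 - z.2 = t at *
  generalize z.1 + z.2 = u at *
  have hα' : α = -1 / 2 := by linarith
  subst hα'
  have e₁ : t * u = 2 * (m₁ - m₂) * d := by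
    refine mul_left_cancel₀ (mul_ne_zero four_ne_zero hd) ?_
    linear_combination h₁ - h₂
  simp only [f, A, eval_add, eval_sub, eval_mul, eval_pow, eval_C, eval_X]
  refine mul_left_cancel₀ (mul_ne_zero two_ne_zero (pow_ne_zero 2 (mul_ne_zero two_ne_zero hd))) ?_
  linear_combination t ^ 2 * (h₁ + h₂) -
    2 * (d ^ 2 - t ^ 2 / 4) * (t * u + 2 * (m₁ - m₂) * d) * e₁

lemma card_le_of_degenerate {p₁₁ p₁₂ p₂₁ p₂₂ : ℝ} (h₁₁ : p₁₁ ≠ 0) (h₂₁ : p₂₁ ≠ 0)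
    (h₁₂ : p₁₂ ≠ 0) (hd : p₁₁ - p₂₁ ≠ p₁₂ - p₂₂) {T : Finset (ℝ × ℝ)}
    (hT : ∀ z ∈ T, z.1 ≠ z.2 ∧ ∃ r₁ r₂, OnQuadric 0 z.1 p₁₁ r₁ ∧ OnQuadric 0 z.2 p₂₁ r₁ ∧
      OnQuadric 0 z.1 p₁₂ r₂ ∧ OnQuadric 0 z.2 p₂₂ r₂) : T.card ≤ 6 := by
  obtain rfl | ⟨z₀, hz₀⟩ := T.eq_empty_or_nonempty
  · simp
  have solve {s p r : ℝ} (hp : p ≠ 0) (h : OnQuadric 0 s p r) :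
      r - p ≠ 0 ∧ s = (r - p) + p / (r - p) := by
    have h' : (r - p) * (s - (r - p)) = p := by
      unfold OnQuadric at h
      linear_combination -h
    have h0 : r - p ≠ 0 := fun h0 => hp (by rw [← h', h0, zero_mul])
    refine ⟨h0, ?_⟩
    field_simp
    linear_combination h'
  have sub_ne_zero_of {s₁ s₂ p₁ p₂ r : ℝ} (hp : p₁ ≠ 0) (hs : s₁ ≠ s₂)
      (h₁ : OnQuadric 0 s₁ p₁ r) (h₂ : OnQuadric 0 s₂ p₂ r) : p₁ - p₂ ≠ 0 := by
    intro h
    obtain rfl : p₁ = p₂ := sub_eq_zero.1 h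
    exact hs ((solve hp h₁).2.trans (solve hp h₂).2.symm)
  obtain ⟨hz, r₁, r₂, e₁, e₂, e₃, e₄⟩ := hT z₀ hz₀
  have hd₁ := sub_ne_zero_of h₁₁ hz e₁ e₂
  have hd₂ := sub_ne_zero_of h₁₂ hz e₃ e₄
  clear hz e₁ e₂ e₃ e₄ r₁ r₂ hz₀ z₀
  obtain ⟨d₁, hd₁'⟩ : ∃ d₁, d₁ = p₁₁ - p₂₁ := ⟨_, rfl⟩
  obtain ⟨d₂, hd₂'⟩ : ∃ d₂, d₂ = p₁₂ - p₂₂ := ⟨_, rfl⟩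
  rw [← hd₁'] at hd₁ hd
  rw [← hd₂'] at hd₂ hd
  let b : ℝ[X] := C (2 * (d₂ - d₁)) * X + C (d₁ * (2 * d₂ - d₁ + 1))
  let c : ℝ[X] := C (-d₂) * X ^ 2 + C (d₂ * (d₂ - 2 * d₁ - 1)) * X +
    C (d₁ * d₂ * (d₂ - d₁) - (p₂₁ * d₂ - p₂₂ * d₁))
  let U : ℝ[X] := C d₁ * (X ^ 2 + C p₁₁) + X * b
  let V : ℝ[X] := X * (C (d₁ * p₁₂) - c)
  let f : ℝ[X] := C d₁ * V ^ 2 + b * U * V + c * U ^ 2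
  have hfn : f.natDegree ≤ 6 := by
    simp only [f, U, V, b, c]
    compute_degree
  have hfc : f.coeff 6 = d₁ * d₂ * (d₁ - d₂) := by
    simp only [f, U, V, b, c]
    compute_degree!
    ring
  have hf : f ≠ 0 := by
    intro h
    rw [h, coeff_zero] at hfc
    exact mul_ne_zero (mul_ne_zero hd₁ hd₂) (sub_ne_zero.2 hd) hfc.symm
  refine (Finset.card_le_card (t := f.roots.toFinset.image fun x =>
    (x + p₁₁ / x, (x + d₁) + p₂₁ / (x + d₁))) fun z hz => ?_).trans (Finset.card_image_le.trans
    ((Multiset.toFinset_card_le _).trans ((card_roots' f).trans hfn)))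
  obtain ⟨-, r₁, r₂, e₁, e₂, e₃, e₄⟩ := hT z hz
  refine Finset.mem_image.2 ⟨r₁ - p₁₁, ?_, ?_⟩
  · rw [Multiset.mem_toFinset, mem_roots hf, IsRoot]
    unfold OnQuadric at e₁ e₂ e₃ e₄
    have hp₂₁ : p₂₁ = p₁₁ - d₁ := by linarith
    have hp₂₂ : p₂₂ = p₁₂ - d₂ := by linarith
    generalize hx : r₁ - p₁₁ = x at *
    generalize hy : r₂ - p₁₂ = y at *
    have cubic : x * y ^ 2 - (x ^ 2 + p₁₁) * y + p₁₂ * x = 0 := by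
      linear_combination (-y) * e₁ + x * e₃
    have conic : d₁ * y ^ 2 + b.eval x * y + c.eval x = 0 := by
      simp only [b, c, eval_add, eval_mul, eval_pow, eval_C, eval_X]
      have e₂' : (x + d₁) * (x + d₁ - z.2) + p₂₁ = 0 := by
        rw [← e₂, ← hx, hp₂₁]; ring
      have e₄' : (y + d₂) * (y + d₂ - z.2) + p₂₂ = 0 := by
        rw [← e₄, ← hy, hp₂₂]; ring
      subst hp₂₁ hp₂₂
      linear_combination (-(y + d₂)) * e₂' + (x + d₁) * e₄' - cubic
    have hUV : y * U.eval x = V.eval x := by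
      simp only [U, V, eval_add, eval_sub, eval_mul, eval_pow, eval_C, eval_X]
      linear_combination x * conic - d₁ * cubic
    simp only [f, eval_add, eval_mul, eval_pow, eval_C]
    rw [← hUV]
    linear_combination (U.eval x) ^ 2 * conic
  · obtain ⟨-, h₁⟩ := solve h₁₁ e₁
    obtain ⟨-, h₂⟩ := solve h₂₁ e₂
    have : r₁ - p₂₁ = r₁ - p₁₁ + d₁ := by rw [hd₁']; ring
    rw [this] at h₂
    exact Prod.ext h₁.symm h₂.symm

lemma card_le_of_eq_difference {α d m₁ m₂ : ℝ} (hm : m₁ ≠ m₂) {T : Finset (ℝ × ℝ)}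
    (hT : ∀ z ∈ T, z.1 ≠ z.2 ∧ (2 * α + 1 = 0 → z.1 + z.2 ≠ 0) ∧
      (∃ Y, (2 * d + (2 * α + 1) * (z.1 - z.2)) * Y = 4 * d - (z.1 - z.2) * (z.1 + z.2)) ∧
      PairEquation α d m₁ (z.1 - z.2) (z.1 + z.2) ∧
      PairEquation α d m₂ (z.1 - z.2) (z.1 + z.2)) : T.card ≤ 1 := by
  have key : ∀ z ∈ T, 2 * α + 1 ≠ 0 ∧ 2 * d + (2 * α + 1) * (z.1 - z.2) = 0 ∧
      (z.1 - z.2) * (z.1 + z.2) = 4 * d := by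
    intro z hz
    obtain ⟨hne, hσ, ⟨Y, hY⟩, h₁, h₂⟩ := hT z hz
    have hK : 2 * d + (2 * α + 1) * (z.1 - z.2) = 0 := by
      have : (m₁ - m₂) * (2 * d + (2 * α + 1) * (z.1 - z.2)) ^ 2 = 0 := by
        unfold PairEquation at h₁ h₂
        linear_combination (h₂ - h₁) / 2
      simpa [sub_ne_zero.2 hm] using this
    rw [hK, zero_mul] at hY
    refine ⟨fun hα => ?_, hK, by linarith⟩
    have hd : d = 0 := by simpa [hα] using hK
    have := hσ hα
    have h0 : (z.1 - z.2) * (z.1 + z.2) = 0 := by rw [hd] at hY; linarith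
    exact (mul_ne_zero (sub_ne_zero.2 hne) this) h0
  refine Finset.card_le_one.2 fun z hz w hw => ?_
  obtain ⟨hα, hz₁, hz₂⟩ := key z hz
  obtain ⟨-, hw₁, hw₂⟩ := key w hw
  have ht : z.1 - z.2 = w.1 - w.2 := mul_left_cancel₀ hα (by linarith)
  have hu : z.1 + z.2 = w.1 + w.2 := by
    refine mul_left_cancel₀ (sub_ne_zero.2 (hT z hz).1) ?_
    rw [hz₂, ht, hw₂]
  ext <;> linarith

/-- Two distinct pairs of products have a bounded number of pairs of sums in common. -/
theorem card_common_le {α p₁₁ p₁₂ p₂₁ p₂₂ : ℝ} (h₁₁ : p₁₁ ≠ 0) (h₂₁ : p₂₁ ≠ 0)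
    (h₁₂ : p₁₂ ≠ 0) (hne : (p₁₁, p₂₁) ≠ (p₁₂, p₂₂)) {T : Finset (ℝ × ℝ)}
    (hT : ∀ z ∈ T, z.1 ≠ z.2 ∧ (2 * α + 1 = 0 → z.1 + z.2 ≠ 0) ∧
      ∃ r₁ r₂, OnQuadric α z.1 p₁₁ r₁ ∧ OnQuadric α z.2 p₂₁ r₁ ∧
        OnQuadric α z.1 p₁₂ r₂ ∧ OnQuadric α z.2 p₂₂ r₂) : T.card ≤ 20 := by
  have hpair : ∀ z ∈ T, z.1 ≠ z.2 ∧
      PairEquation α (p₁₁ - p₂₁) (p₁₁ + p₂₁) (z.1 - z.2) (z.1 + z.2) ∧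
      PairEquation α (p₁₂ - p₂₂) (p₁₂ + p₂₂) (z.1 - z.2) (z.1 + z.2) := fun z hz => by
    obtain ⟨h, -, r₁, r₂, e₁, e₂, e₃, e₄⟩ := hT z hz
    exact ⟨h, e₁.quadratic e₂, e₃.quadratic e₄⟩
  by_cases hd : p₁₁ - p₂₁ = p₁₂ - p₂₂
  · refine (card_le_of_eq_difference (α := α) (d := p₁₁ - p₂₁) (m₁ := p₁₁ + p₂₁)
      (m₂ := p₁₂ + p₂₂) (fun h => hne ?_) fun z hz => ?_).trans (by norm_num)
    · ext <;> dsimp only <;> linarith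
    · obtain ⟨h, hσ, r₁, r₂, e₁, e₂, -⟩ := hT z hz
      exact ⟨h, hσ, ⟨_, e₁.linear e₂⟩, (hpair z hz).2.1, by rw [hd]; exact (hpair z hz).2.2⟩
  by_cases hα : α * (α + 1) = 0
  · refine le_trans ?_ (show 6 ≤ 20 by norm_num)
    rcases mul_eq_zero.1 hα with rfl | h
    · exact card_le_of_degenerate h₁₁ h₂₁ h₁₂ hd fun z hz => ⟨(hT z hz).1, (hT z hz).2.2⟩
    · obtain rfl : α = -1 := by linarith
      have hneg (s p r : ℝ) (h : OnQuadric (-1) s p r) : OnQuadric 0 (-s) p r := by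
        unfold OnQuadric at h ⊢
        linear_combination h
      rw [← Finset.card_image_of_injective T (f := fun z : ℝ × ℝ => (-z.1, -z.2))
        (fun z w h => by simpa [Prod.ext_iff] using h)]
      refine card_le_of_degenerate h₁₁ h₂₁ h₁₂ hd fun w hw => ?_
      obtain ⟨z, hz, rfl⟩ := Finset.mem_image.1 hw
      obtain ⟨h, -, r₁, r₂, e₁, e₂, e₃, e₄⟩ := hT z hz
      exact ⟨fun h' => h (neg_injective h'), r₁, r₂, hneg _ _ _ e₁, hneg _ _ _ e₂,
        hneg _ _ _ e₃, hneg _ _ _ e₄⟩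
  by_cases hσ : 2 * α + 1 = 0
  · by_cases hd' : p₁₂ - p₂₂ = -(p₁₁ - p₂₁)
    · have hd0 : p₁₁ - p₂₁ ≠ 0 := fun h0 => hd (by rw [hd', h0, neg_zero])
      rw [hd'] at hpair
      exact (card_le_of_antisymmetric hα hσ hd0 hpair).trans (by norm_num)
    · refine (card_le_of_symmetric hα hσ (fun h => ?_) hpair).trans (by norm_num)
      rcases sq_eq_sq_iff_eq_or_eq_neg.1 h with h | h
      · exact hd h
      · exact hd' (by linarith)
  · exact card_le_of_generic hα hσ hd hpair

end Algebra

section Incidences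

open Finset

lemma card_le_card_image_add_card_pairs {τ κ : Type*} [DecidableEq τ] [DecidableEq κ]
    (I : Finset τ) (f : τ → κ) :
    I.card ≤ (I.image f).card + ((I ×ˢ I).filter fun z => z.1 ≠ z.2 ∧ f z.1 = f z.2).card := by
  obtain rfl | ⟨a₀, -⟩ := I.eq_empty_or_nonempty
  · simp
  have : Nonempty τ := ⟨a₀⟩
  let g : κ → τ := Function.invFunOn f I
  have hg : ∀ a ∈ I, g (f a) ∈ I ∧ f (g (f a)) = f a := fun a ha =>
    ⟨Function.invFunOn_mem ⟨a, ha, rfl⟩, Function.invFunOn_eq ⟨a, ha, rfl⟩⟩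
  rw [← card_filter_add_card_filter_not (s := I) (fun a => g (f a) = a)]
  refine add_le_add ?_ ?_
  · refine card_le_card_of_injOn f (fun a ha => ?_) fun a ha b hb hab => ?_
    · exact mem_image_of_mem f (mem_filter.1 ha).1
    · have ha := (mem_filter.1 ha).2
      have hb := (mem_filter.1 hb).2
      rw [← ha, ← hb, hab]
  · refine card_le_card_of_injOn (fun a => (a, g (f a))) (fun a ha => ?_) fun a _ b _ hab => ?_
    · obtain ⟨ha, hne⟩ := mem_filter.1 ha
      exact mem_filter.2 ⟨mem_product.2 ⟨ha, (hg a ha).1⟩, Ne.symm hne, (hg a ha).2.symm⟩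
    · exact congrArg Prod.fst hab

/-- The index of the block of `k` consecutive elements of `P` to which `v` belongs. -/
noncomputable def blockIndex (P : Finset ℝ) (k : ℕ) (v : ℝ) : ℕ :=
  (P.filter (· < v)).card / k

lemma blockIndex_mono (P : Finset ℝ) (k : ℕ) : Monotone (blockIndex P k) := fun v w h =>
  Nat.div_le_div_right (card_le_card fun x hx => by
    simp only [mem_filter] at hx ⊢
    exact ⟨hx.1, hx.2.trans_le h⟩)

lemma blockIndex_le (P : Finset ℝ) (k : ℕ) (v : ℝ) : blockIndex P k v ≤ P.card / k :=
  Nat.div_le_div_right (card_filter_le _ _)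

lemma rank_strictMonoOn (P : Finset ℝ) :
    StrictMonoOn (fun v => (P.filter (· < v)).card) P := fun v hv w _ h =>
  card_lt_card (by
    refine ⟨fun x hx => ?_, fun hsub => ?_⟩
    · simp only [mem_filter] at hx ⊢
      exact ⟨hx.1, hx.2.trans h⟩
    · have := hsub (mem_filter.2 ⟨hv, h⟩)
      simp at this)

lemma card_same_block_le (P : Finset ℝ) {k : ℕ} (hk : 0 < k) :
    ((P ×ˢ P).filter fun z => blockIndex P k z.1 = blockIndex P k z.2).card ≤ k * P.card := by
  refine (card_le_mul_card_image (f := Prod.fst) _ k fun v _ => ?_).trans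
    (Nat.mul_le_mul_left k (card_le_card fun v hv => ?_))
  · have : (Ico (blockIndex P k v * k) (blockIndex P k v * k + k)).card = k := by simp
    refine le_trans ?_ this.le
    refine card_le_card_of_injOn (fun z => (P.filter (· < z.2)).card) (fun z hz => ?_)
      fun z hz w hw h => ?_
    · obtain ⟨hzP, rfl⟩ := mem_filter.1 hz
      have hb : blockIndex P k z.1 = blockIndex P k z.2 := (mem_filter.1 hzP).2
      rw [coe_Ico, Set.mem_Ico, hb]
      unfold blockIndex
      exact ⟨Nat.div_mul_le_self _ _, Nat.lt_div_mul_add hk⟩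
    · simp only [mem_coe, mem_filter, mem_product] at hz hw
      exact Prod.ext (hz.2.trans hw.2.symm)
        ((rank_strictMonoOn P).injOn hz.1.1.2 hw.1.1.2 h)
  · obtain ⟨z, hz, rfl⟩ := mem_image.1 hv
    exact (mem_product.1 (mem_filter.1 hz).1).1

/-- An incidence bound between the points of the grid `P ×ˢ P` and a family of strictly increasing
curves, any two distinct points lying on at most `C` common curves. An incidence `a ∈ I` involves
the point `(x a, y a)` and the curve `c a`. -/
theorem card_incidences_le {τ γ : Type*} [DecidableEq τ] [DecidableEq γ] (I : Finset τ)
    (c : τ → γ) (x y : τ → ℝ) (P : Finset ℝ) {N L C k : ℕ} (hk : 0 < k) (hP : P.card ≤ N)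
    (hx : ∀ a ∈ I, x a ∈ P) (hy : ∀ a ∈ I, y a ∈ P) (hL : (I.image c).card ≤ L)
    (hinj : ∀ a ∈ I, ∀ b ∈ I, c a = c b → x a = x b → a = b)
    (hmono : ∀ a ∈ I, ∀ b ∈ I, c a = c b → x a < x b → y a < y b)
    (hC : ∀ x₁ y₁ x₂ y₂ : ℝ, (x₁, y₁) ≠ (x₂, y₂) → ∀ T : Finset γ,
      (∀ t ∈ T, ∃ a ∈ I, ∃ b ∈ I, c a = t ∧ c b = t ∧
        x a = x₁ ∧ y a = y₁ ∧ x b = x₂ ∧ y b = y₂) → T.card ≤ C) :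
    I.card ≤ L * (2 * (N / k) + 1) + C * (k * N) ^ 2 := by
  let φ := blockIndex P k
  have hφ : Monotone φ := blockIndex_mono P k
  let f : τ → γ × ℕ := fun a => (c a, φ (x a) + φ (y a))
  refine (card_le_card_image_add_card_pairs I f).trans (add_le_add ?_ ?_)
  · have hsub : I.image f ⊆ (I.image c) ×ˢ range (2 * (N / k) + 1) := fun z hz => by
      obtain ⟨a, ha, rfl⟩ := mem_image.1 hz
      refine mem_product.2 ⟨mem_image_of_mem c ha, mem_range.2 ?_⟩
      have h₁ := blockIndex_le P k (x a)
      have h₂ := blockIndex_le P k (y a)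
      have h₃ : P.card / k ≤ N / k := Nat.div_le_div_right hP
      simp only [f, φ]
      omega
    refine (card_le_card hsub).trans ?_
    rw [card_product, card_range]
    exact Nat.mul_le_mul_right _ hL
  · let Q := (P ×ˢ P).filter fun z => φ z.1 = φ z.2
    have hQ : Q.card ≤ k * N :=
      (card_same_block_le P hk).trans (Nat.mul_le_mul_left k hP)
    let R := (I ×ˢ I).filter fun z => z.1 ≠ z.2 ∧ f z.1 = f z.2
    let h : τ × τ → (ℝ × ℝ) × (ℝ × ℝ) := fun z => ((x z.1, x z.2), (y z.1, y z.2))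
    have hR : ∀ z ∈ R, z.1 ∈ I ∧ z.2 ∈ I ∧ z.1 ≠ z.2 ∧ c z.1 = c z.2 ∧
        φ (x z.1) + φ (y z.1) = φ (x z.2) + φ (y z.2) := fun z hz => by
      obtain ⟨hz, hne, he⟩ := mem_filter.1 hz
      exact ⟨(mem_product.1 hz).1, (mem_product.1 hz).2, hne, congrArg Prod.fst he,
        congrArg Prod.snd he⟩
    have himage : R.image h ⊆ Q ×ˢ Q := fun w hw => by
      obtain ⟨z, hz, rfl⟩ := mem_image.1 hw
      obtain ⟨h₁, h₂, hne, hc, hs⟩ := hR z hz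
      have : φ (x z.1) = φ (x z.2) ∧ φ (y z.1) = φ (y z.2) := by
        rcases lt_trichotomy (x z.1) (x z.2) with hlt | heq | hlt
        · have := hφ hlt.le
          have := hφ (hmono _ h₁ _ h₂ hc hlt).le
          omega
        · exact absurd (hinj _ h₁ _ h₂ hc heq) hne
        · have := hφ hlt.le
          have := hφ (hmono _ h₂ _ h₁ hc.symm hlt).le
          omega
      simp only [h, Q, mem_product, mem_filter]
      exact ⟨⟨⟨hx _ h₁, hx _ h₂⟩, this.1⟩, ⟨hy _ h₁, hy _ h₂⟩, this.2⟩
    refine (card_le_mul_card_image (s := R) (f := h) C fun w hw => ?_).trans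
      (Nat.mul_le_mul_left C ((card_le_card himage).trans ?_))
    · obtain ⟨z₀, hz₀, rfl⟩ := mem_image.1 hw
      obtain ⟨h₁, h₂, hne, hc, -⟩ := hR z₀ hz₀
      have hpt : (x z₀.1, y z₀.1) ≠ (x z₀.2, y z₀.2) := fun he =>
        hne (hinj _ h₁ _ h₂ hc (congrArg Prod.fst he))
      rw [← card_image_of_injOn (f := fun z : τ × τ => c z.1)]
      · refine hC _ _ _ _ hpt _ fun t ht => ?_
        obtain ⟨z, hz, rfl⟩ := mem_image.1 ht
        obtain ⟨hz, he⟩ := mem_filter.1 hz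
        obtain ⟨h₁, h₂, -, hc, -⟩ := hR z hz
        simp only [h, Prod.mk.injEq] at he
        exact ⟨z.1, h₁, z.2, h₂, rfl, hc.symm, he.1.1, he.2.1, he.1.2, he.2.2⟩
      · intro z hz w hw hzw
        obtain ⟨hz, hze⟩ := mem_filter.1 hz
        obtain ⟨hw, hwe⟩ := mem_filter.1 hw
        obtain ⟨z₁, z₂, -, hzc, -⟩ := hR z hz
        obtain ⟨w₁, w₂, -, hwc, -⟩ := hR w hw
        have he := hze.trans hwe.symm
        simp only [h, Prod.mk.injEq] at he
        exact Prod.ext (hinj _ z₁ _ w₁ hzw he.1.1)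
          (hinj _ z₂ _ w₂ (hzc.symm.trans (hzw.trans hwc)) he.1.2)
    · rw [card_product, sq]
      exact Nat.mul_le_mul hQ hQ

lemma card_sq_le_card_image_mul_card_pairs {τ κ : Type*} [DecidableEq τ] [DecidableEq κ]
    (H : Finset τ) (f : τ → κ) :
    H.card ^ 2 ≤ (H.image f).card * ((H ×ˢ H).filter fun z => f z.1 = f z.2).card := by
  have h₁ : H.card = ∑ t ∈ H.image f, (H.filter fun a => f a = t).card :=
    card_eq_sum_card_image f H
  have h₂ : ((H ×ˢ H).filter fun z => f z.1 = f z.2).card =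
      ∑ t ∈ H.image f, (H.filter fun a => f a = t).card ^ 2 := by
    rw [card_eq_sum_card_fiberwise (f := fun z => f z.1) (t := H.image f) fun z hz =>
      mem_image_of_mem f (mem_product.1 (mem_filter.1 hz).1).1]
    refine sum_congr rfl fun t _ => ?_
    rw [sq, ← card_product]
    congr 1
    ext z
    simp only [mem_filter, mem_product]
    constructor
    · rintro ⟨⟨⟨h₁, h₂⟩, h₃⟩, h₄⟩
      exact ⟨⟨h₁, h₄⟩, h₂, h₃ ▸ h₄⟩
    · rintro ⟨⟨h₁, h₄⟩, h₂, h₃⟩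
      exact ⟨⟨⟨h₁, h₂⟩, h₄.trans h₃.symm⟩, h₄⟩
  rw [h₂]
  conv_lhs => rw [h₁]
  exact sq_sum_le_card_mul_sum_sq

end Incidences

section Energy

open Finset

/-- The sum `a + b` of a pair `(a, b)`. -/
def pairSum (z : ℝ × ℝ) : ℝ := z.1 + z.2

/-- The product `a * b` of a pair `(a, b)`. -/
def pairProd (z : ℝ × ℝ) : ℝ := z.1 * z.2

/-- The product `(a + α) * (b + α + 1)` of the shifts of a pair `(a, b)`, the shifts differing by
one. -/
def shiftedProd (α : ℝ) (z : ℝ × ℝ) : ℝ := (z.1 + α) * (z.2 + (α + 1))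

lemma onQuadric_shiftedProd (α : ℝ) (z : ℝ × ℝ) :
    OnQuadric α (pairSum z) (pairProd z) (shiftedProd α z - α * (α + 1)) := by
  simp only [OnQuadric, pairSum, pairProd, shiftedProd]
  ring

/-- On `H`, among pairs with the same sum, `f` is either strictly increasing or strictly decreasing
in the first entry. -/
def MonotoneOnSums (H : Finset (ℝ × ℝ)) (f : ℝ × ℝ → ℝ) : Prop :=
  (∀ g ∈ H, ∀ h ∈ H, pairSum g = pairSum h → (f g < f h ↔ g.1 < h.1)) ∨
    ∀ g ∈ H, ∀ h ∈ H, pairSum g = pairSum h → (f g < f h ↔ h.1 < g.1)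

lemma MonotoneOnSums.injective {H : Finset (ℝ × ℝ)} {f : ℝ × ℝ → ℝ} (hf : MonotoneOnSums H f)
    {g h : ℝ × ℝ} (hg : g ∈ H) (hh : h ∈ H) (hs : pairSum g = pairSum h) (he : f g = f h) :
    g = h := by
  have h1 : g.1 = h.1 := by
    rcases hf with hf | hf <;>
    · have e₁ := hf g hg h hh hs
      have e₂ := hf h hh g hg hs.symm
      rw [he] at e₁ e₂
      simp only [lt_irrefl, false_iff, not_lt] at e₁ e₂
      order
  refine Prod.ext h1 ?_
  unfold pairSum at hs
  linarith

lemma MonotoneOnSums.transfer {H : Finset (ℝ × ℝ)} {p q : ℝ × ℝ → ℝ} (hp : MonotoneOnSums H p)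
    (hq : MonotoneOnSums H q) {g h g' h' : ℝ × ℝ} (hg : g ∈ H) (hh : h ∈ H) (hg' : g' ∈ H)
    (hh' : h' ∈ H) (hs : pairSum g = pairSum h) (hs' : pairSum g' = pairSum h')
    (hqg : q g = q g') (hqh : q h = q h') (hlt : p g < p h) : p g' < p h' := by
  rcases hp with hp | hp <;> rcases hq with hq | hq
  · rw [hp _ hg' _ hh' hs', ← hq _ hg' _ hh' hs', ← hqg, ← hqh, hq _ hg _ hh hs,
      ← hp _ hg _ hh hs]
    exact hlt
  · rw [hp _ hg' _ hh' hs', ← hq _ hh' _ hg' hs'.symm, ← hqg, ← hqh, hq _ hh _ hg hs.symm,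
      ← hp _ hg _ hh hs]
    exact hlt
  · rw [hp _ hg' _ hh' hs', ← hq _ hh' _ hg' hs'.symm, ← hqg, ← hqh, hq _ hh _ hg hs.symm,
      ← hp _ hg _ hh hs]
    exact hlt
  · rw [hp _ hg' _ hh' hs', ← hq _ hg' _ hh' hs', ← hqg, ← hqh, hq _ hg _ hh hs,
      ← hp _ hg _ hh hs]
    exact hlt

lemma monotoneOnSums_of_factor {H : Finset (ℝ × ℝ)} {f e : ℝ × ℝ → ℝ}
    (he : (∀ z ∈ H, 0 < e z) ∨ ∀ z ∈ H, e z < 0)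
    (hf : ∀ g h, pairSum g = pairSum h → 2 * (f h - f g) = (h.1 - g.1) * (e g + e h)) :
    MonotoneOnSums H f := by
  rcases he with he | he
  · refine Or.inl fun g hg h hh hs => ?_
    have hpos := add_pos (he g hg) (he h hh)
    rw [← sub_pos (b := f g), ← sub_pos (b := g.1),
      show 0 < (h.1 - g.1) ↔ _ from (mul_pos_iff_of_pos_right hpos).symm, ← hf g h hs]
    simp
  · refine Or.inr fun g hg h hh hs => ?_
    have hpos := neg_pos.2 (add_neg (he g hg) (he h hh))
    rw [← sub_pos (b := f g), ← sub_pos (b := h.1),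
      show 0 < (g.1 - h.1) ↔ _ from (mul_pos_iff_of_pos_right hpos).symm]
    have : (g.1 - h.1) * -(e g + e h) = 2 * (f h - f g) := by rw [hf g h hs]; ring
    rw [this]
    simp

theorem card_sq_le_of_monotoneOnSums {α : ℝ} {H : Finset (ℝ × ℝ)} {N k : ℕ} (hk : 0 < k)
    (hs : (H.image pairSum).card ≤ N) (hp : (H.image pairProd).card ≤ N)
    (hq : (H.image (shiftedProd α)).card ≤ N) (hp₀ : ∀ z ∈ H, pairProd z ≠ 0)
    (hpm : MonotoneOnSums H pairProd) (hqm : MonotoneOnSums H (shiftedProd α)) :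
    H.card ^ 2 ≤ N * (2 * H.card + (N ^ 2 * (2 * (N / k) + 1) + 20 * (k * N) ^ 2)) := by
  refine (card_sq_le_card_image_mul_card_pairs H (shiftedProd α)).trans (Nat.mul_le_mul hq ?_)
  set E := (H ×ˢ H).filter fun z => shiftedProd α z.1 = shiftedProd α z.2 with hE
  let I := E.filter fun z => pairSum z.1 ≠ pairSum z.2 ∧ pairSum z.1 + pairSum z.2 ≠ 0
  have hEmem : ∀ z ∈ E, z.1 ∈ H ∧ z.2 ∈ H ∧ shiftedProd α z.1 = shiftedProd α z.2 := fun z hz =>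
    ⟨(mem_product.1 (mem_filter.1 hz).1).1, (mem_product.1 (mem_filter.1 hz).1).2,
      (mem_filter.1 hz).2⟩
  have hImem : ∀ z ∈ I, z.1 ∈ H ∧ z.2 ∈ H ∧ shiftedProd α z.1 = shiftedProd α z.2 ∧
      pairSum z.1 ≠ pairSum z.2 ∧ pairSum z.1 + pairSum z.2 ≠ 0 := fun z hz => by
    obtain ⟨hz, h⟩ := mem_filter.1 hz
    obtain ⟨h₁, h₂, h₃⟩ := hEmem z hz
    exact ⟨h₁, h₂, h₃, h⟩
  have hsplit : E ⊆ (E.filter fun z => pairSum z.1 = pairSum z.2) ∪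
      (E.filter fun z => pairSum z.1 + pairSum z.2 = 0) ∪ I := fun z hz => by
    simp only [I, mem_union, mem_filter]
    tauto
  have hbad (F : ℝ × ℝ → ℝ × ℝ → Prop) [DecidablePred fun z : (ℝ × ℝ) × (ℝ × ℝ) => F z.1 z.2]
      (hF : ∀ g h h', F g h → F g h' → pairSum h = pairSum h') :
      (E.filter fun z => F z.1 z.2).card ≤ H.card := by
    refine card_le_card_of_injOn Prod.fst (fun z hz => (hEmem z (mem_filter.1 hz).1).1) ?_
    intro z hz w hw hzw
    obtain ⟨hz, hzF⟩ := mem_filter.1 hz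
    obtain ⟨hw, hwF⟩ := mem_filter.1 hw
    obtain ⟨-, z₂, hzq⟩ := hEmem z hz
    obtain ⟨-, w₂, hwq⟩ := hEmem w hw
    rw [← hzw] at hwF hwq
    exact Prod.ext hzw (hqm.injective z₂ w₂ (hF _ _ _ hzF hwF) (hzq.symm.trans hwq))
  have hb₁ := hbad (fun g h => pairSum g = pairSum h) fun g h h' e e' => e.symm.trans e'
  have hb₂ := hbad (fun g h => pairSum g + pairSum h = 0) fun g h h' e e' => by linarith
  have hI : I.card ≤ N ^ 2 * (2 * (N / k) + 1) + 20 * (k * N) ^ 2 := by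
    refine card_incidences_le I (fun z => (pairSum z.1, pairSum z.2)) (fun z => pairProd z.1)
      (fun z => pairProd z.2) (H.image pairProd) hk hp ?_ ?_ ?_ ?_ ?_ ?_
    · exact fun z hz => mem_image_of_mem _ (hImem z hz).1
    · exact fun z hz => mem_image_of_mem _ (hImem z hz).2.1
    · have hsub : I.image (fun z => (pairSum z.1, pairSum z.2)) ⊆
          H.image pairSum ×ˢ H.image pairSum := fun w hw => by
        obtain ⟨z, hz, rfl⟩ := mem_image.1 hw
        exact mem_product.2 ⟨mem_image_of_mem _ (hImem z hz).1, mem_image_of_mem _ (hImem z hz).2.1⟩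
      refine (card_le_card hsub).trans ?_
      rw [card_product, sq]
      exact Nat.mul_le_mul hs hs
    · intro z hz w hw hc hx
      obtain ⟨z₁, z₂, hzq, -⟩ := hImem z hz
      obtain ⟨w₁, w₂, hwq, -⟩ := hImem w hw
      obtain ⟨hc₁, hc₂⟩ := Prod.mk.inj hc
      have h₁ := hpm.injective z₁ w₁ hc₁ hx
      exact Prod.ext h₁ (hqm.injective z₂ w₂ hc₂ (by rw [← hzq, ← hwq, h₁]))
    · intro z hz w hw hc hx
      obtain ⟨z₁, z₂, hzq, -⟩ := hImem z hz
      obtain ⟨w₁, w₂, hwq, -⟩ := hImem w hw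
      obtain ⟨hc₁, hc₂⟩ := Prod.mk.inj hc
      exact hpm.transfer hqm z₁ w₁ z₂ w₂ hc₁ hc₂ hzq hwq hx
    · intro x₁ y₁ x₂ y₂ hne T hT
      obtain rfl | ⟨t₀, ht₀⟩ := T.eq_empty_or_nonempty
      · simp
      obtain ⟨z, hz, w, hw, -, -, rfl, rfl, rfl, rfl⟩ := hT t₀ ht₀
      refine card_common_le (α := α) (hp₀ _ (hImem z hz).1) (hp₀ _ (hImem z hz).2.1)
        (hp₀ _ (hImem w hw).1) hne fun t ht => ?_
      obtain ⟨z', hz', w', hw', rfl, hc, e₁, e₂, e₃, e₄⟩ := hT t ht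
      obtain ⟨-, -, hzq, hz₁, hz₂⟩ := hImem z' hz'
      obtain ⟨-, -, hwq, -⟩ := hImem w' hw'
      obtain ⟨hc₁, hc₂⟩ := Prod.mk.inj hc
      refine ⟨hz₁, fun _ => hz₂, shiftedProd α z'.1 - α * (α + 1),
        shiftedProd α w'.1 - α * (α + 1), ?_, ?_, ?_, ?_⟩
      · rw [← e₁]; exact onQuadric_shiftedProd α z'.1
      · rw [← e₂, hzq]; exact onQuadric_shiftedProd α z'.2
      · rw [← e₃, ← hc₁]; exact onQuadric_shiftedProd α w'.1
      · rw [← e₄, ← hc₂, hwq]; exact onQuadric_shiftedProd α w'.2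
  refine (card_le_card hsplit).trans ((card_union_le _ _).trans ?_)
  have := card_union_le (E.filter fun z => pairSum z.1 = pairSum z.2)
    (E.filter fun z => pairSum z.1 + pairSum z.2 = 0)
  omega

theorem card_le_of_monotoneOnSums {α t : ℝ} {H : Finset (ℝ × ℝ)} {N : ℕ} (ht : 1 ≤ t)
    (hN : (N : ℝ) = t ^ 6)
    (hs : (H.image pairSum).card ≤ N) (hp : (H.image pairProd).card ≤ N)
    (hq : (H.image (shiftedProd α)).card ≤ N) (hp₀ : ∀ z ∈ H, pairProd z ≠ 0)
    (hpm : MonotoneOnSums H pairProd) (hqm : MonotoneOnSums H (shiftedProd α)) :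
    (H.card : ℝ) ≤ 12 * t ^ 11 := by
  have ht0 : 0 < t := by linarith
  have hk₁ : t ^ 2 ≤ ⌈t ^ 2⌉₊ := Nat.le_ceil _
  have hk₂ : (⌈t ^ 2⌉₊ : ℝ) ≤ 2 * t ^ 2 := by
    have h₁ := Nat.ceil_lt_add_one (sq_nonneg t)
    have h₂ := one_le_pow₀ ht (n := 2)
    linarith
  have hk : 0 < ⌈t ^ 2⌉₊ := Nat.ceil_pos.2 (by positivity)
  have hmain := card_sq_le_of_monotoneOnSums hk hs hp hq hp₀ hpm hqm
  generalize ⌈t ^ 2⌉₊ = k at *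
  generalize H.card = h at *
  have hdiv : ((N / k : ℕ) : ℝ) ≤ t ^ 4 := by
    refine Nat.cast_div_le.trans ?_
    rw [div_le_iff₀ (by positivity), hN]
    calc t ^ 6 = t ^ 4 * t ^ 2 := by ring
      _ ≤ t ^ 4 * k := by gcongr
  have hmain' : (h : ℝ) ^ 2 ≤
      N * (2 * h + (N ^ 2 * (2 * ((N / k : ℕ) : ℝ) + 1) + 20 * (k * N) ^ 2)) := by
    exact_mod_cast hmain
  have hle : (h : ℝ) ^ 2 ≤ t ^ 6 * (2 * h + 83 * t ^ 16) := by
    refine hmain'.trans ?_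
    rw [hN]
    have h₁ : (t ^ 6) ^ 2 * (2 * ((N / k : ℕ) : ℝ) + 1) ≤ (t ^ 6) ^ 2 * (3 * t ^ 4) := by
      have := one_le_pow₀ ht (n := 4)
      gcongr
      linarith
    have h₂ : 20 * ((k : ℝ) * t ^ 6) ^ 2 ≤ 20 * (2 * t ^ 2 * t ^ 6) ^ 2 := by gcongr
    gcongr
    linarith
  by_contra! hlt
  have h₁ : t ^ 6 ≤ t ^ 11 := pow_le_pow_right₀ ht (by norm_num)
  have h₂ : (0 : ℝ) < t ^ 11 := by positivity
  have h₃ : t ^ 6 * h ≤ t ^ 11 * h := by gcongr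
  have h₄ : t ^ 6 * t ^ 16 = t ^ 11 * t ^ 11 := by ring
  nlinarith

lemma card_zero_set_le {G : Finset (ℝ × ℝ)} {N : ℕ} (hs : (G.image pairSum).card ≤ N)
    (F : ℝ × ℝ → Prop) [DecidablePred F]
    (hF : ∀ g h, F g → F h → pairSum g = pairSum h → g = h) : (G.filter F).card ≤ N := by
  refine le_trans (card_le_card_of_injOn pairSum (fun z hz => ?_) fun g hg h hh => ?_) hs
  · exact mem_image_of_mem _ (mem_filter.1 hz).1
  · exact hF g h (mem_filter.1 hg).2 (mem_filter.1 hh).2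

theorem card_le_of_unit_shift {α t : ℝ} {G : Finset (ℝ × ℝ)} {N : ℕ} (ht : 1 ≤ t)
    (hN : (N : ℝ) = t ^ 6)
    (hs : (G.image pairSum).card ≤ N) (hp : (G.image pairProd).card ≤ N)
    (hq : (G.image (shiftedProd α)).card ≤ N) : (G.card : ℝ) ≤ 40 * t ^ 11 := by
  have hpiece (F : ℝ × ℝ → Prop) [DecidablePred F]
      (h₁ : (∀ z, F z → 0 < z.2 - z.1) ∨ ∀ z, F z → z.2 - z.1 < 0)
      (h₂ : (∀ z, F z → 0 < z.2 - z.1 + 1) ∨ ∀ z, F z → z.2 - z.1 + 1 < 0) :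
      ((G.filter fun z => pairProd z ≠ 0 ∧ F z).card : ℝ) ≤ 12 * t ^ 11 := by
    have hsub := filter_subset (fun z => pairProd z ≠ 0 ∧ F z) G
    have hF : ∀ z ∈ G.filter (fun z => pairProd z ≠ 0 ∧ F z), F z :=
      fun z hz => (mem_filter.1 hz).2.2
    refine card_le_of_monotoneOnSums (α := α) ht hN
      ((card_le_card (image_subset_image hsub)).trans hs)
      ((card_le_card (image_subset_image hsub)).trans hp)
      ((card_le_card (image_subset_image hsub)).trans hq) (fun z hz => (mem_filter.1 hz).2.1)
      (monotoneOnSums_of_factor (e := fun z => z.2 - z.1) ?_ fun g h e => ?_)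
      (monotoneOnSums_of_factor (e := fun z => z.2 - z.1 + 1) ?_ fun g h e => ?_)
    · exact h₁.imp (fun h z hz => h z (hF z hz)) (fun h z hz => h z (hF z hz))
    · simp only [pairProd, pairSum] at e ⊢
      linear_combination (-g.1 - h.1) * e
    · exact h₂.imp (fun h z hz => h z (hF z hz)) (fun h z hz => h z (hF z hz))
    · simp only [shiftedProd, pairSum] at e ⊢
      linear_combination (-g.1 - h.1 - 2 * α) * e
  have c₁ := hpiece (fun z => 0 < z.2 - z.1) (Or.inl fun _ h => h)
    (Or.inl fun _ h => by linarith)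
  have c₂ := hpiece (fun z => z.2 - z.1 < 0 ∧ 0 < z.2 - z.1 + 1) (Or.inr fun _ h => h.1)
    (Or.inl fun _ h => h.2)
  have c₃ := hpiece (fun z => z.2 - z.1 + 1 < 0) (Or.inr fun _ h => by linarith)
    (Or.inr fun _ h => h)
  have e₁ := card_zero_set_le hs (fun z => z.1 = 0) fun g h e e' hs => by
    simp only [pairSum] at hs; ext <;> linarith
  have e₂ := card_zero_set_le hs (fun z => z.2 = 0) fun g h e e' hs => by
    simp only [pairSum] at hs; ext <;> linarith
  have e₃ := card_zero_set_le hs (fun z => z.2 - z.1 = 0) fun g h e e' hs => by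
    simp only [pairSum] at hs; ext <;> linarith
  have e₄ := card_zero_set_le hs (fun z => z.2 - z.1 + 1 = 0) fun g h e e' hs => by
    simp only [pairSum] at hs; ext <;> linarith
  have hcover : G ⊆ ((G.filter fun z => z.1 = 0) ∪ (G.filter fun z => z.2 = 0)) ∪
      ((G.filter fun z => z.2 - z.1 = 0) ∪ (G.filter fun z => z.2 - z.1 + 1 = 0)) ∪
      ((G.filter fun z => pairProd z ≠ 0 ∧ 0 < z.2 - z.1) ∪
        ((G.filter fun z => pairProd z ≠ 0 ∧ z.2 - z.1 < 0 ∧ 0 < z.2 - z.1 + 1) ∪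
          (G.filter fun z => pairProd z ≠ 0 ∧ z.2 - z.1 + 1 < 0))) := fun z hz => by
    simp only [mem_union, mem_filter, hz, true_and, pairProd, mul_ne_zero_iff, ne_eq]
    have h₁ := lt_trichotomy (z.2 - z.1) 0
    have h₂ := lt_trichotomy (z.2 - z.1 + 1) 0
    tauto
  have hcard := card_le_card hcover
  have u₁ := card_union_le (((G.filter fun z => z.1 = 0) ∪ (G.filter fun z => z.2 = 0)) ∪
      ((G.filter fun z => z.2 - z.1 = 0) ∪ (G.filter fun z => z.2 - z.1 + 1 = 0)))
      ((G.filter fun z => pairProd z ≠ 0 ∧ 0 < z.2 - z.1) ∪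
        ((G.filter fun z => pairProd z ≠ 0 ∧ z.2 - z.1 < 0 ∧ 0 < z.2 - z.1 + 1) ∪
          (G.filter fun z => pairProd z ≠ 0 ∧ z.2 - z.1 + 1 < 0)))
  have u₂ := card_union_le ((G.filter fun z => z.1 = 0) ∪ (G.filter fun z => z.2 = 0))
      ((G.filter fun z => z.2 - z.1 = 0) ∪ (G.filter fun z => z.2 - z.1 + 1 = 0))
  have u₃ := card_union_le (G.filter fun z => z.1 = 0) (G.filter fun z => z.2 = 0)
  have u₄ := card_union_le (G.filter fun z => z.2 - z.1 = 0) (G.filter fun z => z.2 - z.1 + 1 = 0)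
  have u₅ := card_union_le (G.filter fun z => pairProd z ≠ 0 ∧ 0 < z.2 - z.1)
        ((G.filter fun z => pairProd z ≠ 0 ∧ z.2 - z.1 < 0 ∧ 0 < z.2 - z.1 + 1) ∪
          (G.filter fun z => pairProd z ≠ 0 ∧ z.2 - z.1 + 1 < 0))
  have u₆ := card_union_le
    (G.filter fun z => pairProd z ≠ 0 ∧ z.2 - z.1 < 0 ∧ 0 < z.2 - z.1 + 1)
    (G.filter fun z => pairProd z ≠ 0 ∧ z.2 - z.1 + 1 < 0)
  have hnat : G.card ≤ 4 * N + ((G.filter fun z => pairProd z ≠ 0 ∧ 0 < z.2 - z.1).card +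
      ((G.filter fun z => pairProd z ≠ 0 ∧ z.2 - z.1 < 0 ∧ 0 < z.2 - z.1 + 1).card +
        (G.filter fun z => pairProd z ≠ 0 ∧ z.2 - z.1 + 1 < 0).card)) := by
    omega
  have hreal := Nat.cast_le (α := ℝ).2 hnat
  push_cast at hreal
  have h₁ : t ^ 6 ≤ t ^ 11 := pow_le_pow_right₀ ht (by norm_num)
  rw [hN] at hreal
  linarith

end Energy

/-- A variant of the main theorem: there is an absolute constant `c > 0` such
that for all finite `A, B ⊆ ℝ`, `G ⊆ A × B` and `α ≠ β`,
`max {|A +_G B|, |A ·_G B|, |(A+α) ·_G (B+β)|} ≥ c · |G|^(6/11)`. -/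
theorem sums_products_shifted_products :
    ∃ c : ℝ, 0 < c ∧
      ∀ (A B : Finset ℝ) (G : Finset (ℝ × ℝ)), G ⊆ A ×ˢ B →
        ∀ α β : ℝ, α ≠ β →
          c * (G.card : ℝ) ^ ((6 : ℝ) / 11) ≤
            ((max (max (G.image (fun p => p.1 + p.2)).card
                       (G.image (fun p => p.1 * p.2)).card)
                  (G.image (fun p => (p.1 + α) * (p.2 + β))).card : ℕ) : ℝ) := by
  refine ⟨1 / 40, by norm_num, fun A B G _ α β hαβ => ?_⟩
  obtain rfl | hG := G.eq_empty_or_nonempty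
  · simp
  generalize hN : max (max (G.image (fun p => p.1 + p.2)).card
    (G.image (fun p => p.1 * p.2)).card) (G.image (fun p => (p.1 + α) * (p.2 + β))).card = N
  have hs : (G.image (fun p => p.1 + p.2)).card ≤ N := by omega
  have hp : (G.image (fun p => p.1 * p.2)).card ≤ N := by omega
  have hq : (G.image (fun p => (p.1 + α) * (p.2 + β))).card ≤ N := by omega
  have hN1 : 1 ≤ N := (Finset.card_pos.2 (hG.image _)).trans_le hs
  have hN1' : (1 : ℝ) ≤ N := by exact_mod_cast hN1
  obtain ⟨t, ht⟩ : ∃ t : ℝ, t = (N : ℝ) ^ ((1 : ℝ) / 6) := ⟨_, rfl⟩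
  have ht1 : 1 ≤ t := by
    rw [ht]
    exact Real.one_le_rpow hN1' (by norm_num)
  have htN : (N : ℝ) = t ^ 6 := by
    rw [ht, ← Real.rpow_natCast, ← Real.rpow_mul (by positivity)]
    norm_num
  have hδ : β - α ≠ 0 := sub_ne_zero.2 hαβ.symm
  let scale : ℝ × ℝ → ℝ × ℝ := fun z => (z.1 / (β - α), z.2 / (β - α))
  have hscale : Function.Injective scale := fun z w h => by
    simpa [scale, Prod.ext_iff, div_left_inj' hδ] using h
  have himage {f f' : ℝ × ℝ → ℝ} (e : ℝ → ℝ) (hf : ∀ z, f' (scale z) = e (f z))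
      (h : (G.image f).card ≤ N) : ((G.image scale).image f').card ≤ N := by
    have : (G.image scale).image f' = (G.image f).image e := by
      rw [Finset.image_image, Finset.image_image]
      exact congrArg (fun u => G.image u) (funext hf)
    rw [this]
    exact Finset.card_image_le.trans h
  have hcard := card_le_of_unit_shift (α := α / (β - α)) (G := G.image scale) ht1 htN
    (himage (fun x => x / (β - α)) (fun z => by simp only [pairSum, scale]; field_simp) hs)
    (himage (fun x => x / (β - α) ^ 2) (fun z => by simp only [pairProd, scale]; field_simp) hp)
    (himage (fun x => x / (β - α) ^ 2)
      (fun z => by simp only [shiftedProd, scale]; field_simp; ring) hq)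
  rw [Finset.card_image_of_injective _ hscale] at hcard
  have h40 : (40 : ℝ) ^ ((6 : ℝ) / 11) ≤ 40 := by
    conv_rhs => rw [← Real.rpow_one 40]
    exact Real.rpow_le_rpow_of_exponent_le (by norm_num) (by norm_num)
  have ht11 : (t ^ 11) ^ ((6 : ℝ) / 11) = t ^ 6 := by
    rw [← Real.rpow_natCast, ← Real.rpow_natCast, ← Real.rpow_mul (by linarith)]
    norm_num
  calc 1 / 40 * (G.card : ℝ) ^ ((6 : ℝ) / 11)
      ≤ 1 / 40 * (40 * t ^ 11) ^ ((6 : ℝ) / 11) :=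
        mul_le_mul_of_nonneg_left (Real.rpow_le_rpow (Nat.cast_nonneg _) hcard (by norm_num))
          (by norm_num)
    _ = 1 / 40 * (40 ^ ((6 : ℝ) / 11) * t ^ 6) := by
      rw [Real.mul_rpow (by norm_num) (by positivity), ht11]
    _ ≤ 1 / 40 * (40 * t ^ 6) := by gcongr
    _ = N := by rw [htN]; ring
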